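/- Let τ₁, …, τ_K ∈ Δ_L be linearly independent, let P₁, …, P_L be jointly irreducible probability distributions, and let Q_i = ∑_{m=1}^L τ_{i,m} P_m for i = 1, …, K. Fix j ∈ {1, …, K}, and for each k ∈ {1, …, K} \ {j} let R_k be the residue of Q_k with respect to Q_j, and write R_k = ∑_{m=1}^L η_{k,m} P_m with η_k ∈ Δ_L. Then the K vectors η₁, …, η_{j−1}, τ_j, η_{j+1}, …, η_K are linearly independent. -/

import Mathlib

open MeasureTheory

/-- Probability distributions `P₁, …, P_L` are *jointly irreducible* if whenever a real linear
combination `∑ γᵢ Pᵢ` (in the space of finite signed measures) is a probability distribution,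
all coefficients `γᵢ` are nonnegative. -/
def JointlyIrreducible {X : Type*} [MeasurableSpace X] {L : ℕ}
    (P : Fin L → Measure X) [∀ j, IsProbabilityMeasure (P j)] : Prop :=
  ∀ (γ : Fin L → ℝ) (Q : Measure X) (_ : IsProbabilityMeasure Q),
    Q.toSignedMeasure = ∑ i, γ i • (P i).toSignedMeasure → ∀ i, 0 ≤ γ i

/-- The two-sample operator
`κ*(F₀ | F₁) = sup {κ ∈ [0,1] : ∃ probability G, F₀ = (1−κ)G + κF₁}`. -/
noncomputable def kappaTwo {X : Type*} [MeasurableSpace X]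
    (F₀ F₁ : Measure X) [IsFiniteMeasure F₀] [IsFiniteMeasure F₁] : ℝ :=
  sSup {κ : ℝ | κ ∈ Set.Icc (0 : ℝ) 1 ∧ ∃ (G : Measure X) (_ : IsProbabilityMeasure G),
    F₀.toSignedMeasure = (1 - κ) • G.toSignedMeasure + κ • F₁.toSignedMeasure}

theorem JointlyIrreducible.linearIndependent {X : Type*} [MeasurableSpace X] {L : ℕ}
    {P : Fin L → Measure X} [∀ m, IsProbabilityMeasure (P m)] (h : JointlyIrreducible P) :
    LinearIndependent ℝ (fun m => (P m).toSignedMeasure) := by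
  rw [Fintype.linearIndependent_iff]
  intro β hβ m
  have key : ∀ t : ℝ, 0 ≤ 1 + t * β m := fun t => by
    have hm := h (fun i => Pi.single (M := fun _ => ℝ) m 1 i + t * β i) (P m) inferInstance (by
      simp [add_smul, Finset.sum_add_distrib, mul_smul, ← Finset.smul_sum, hβ,
        Pi.single_apply]) m
    simpa using hm
  by_contra hne
  have := key (-2 * (β m)⁻¹)
  rw [mul_assoc, inv_mul_cancel₀ hne] at this
  norm_num at this

/-- Let `τ₁, …, τ_K ∈ Δ_L` be linearly independent, `P₁, …, P_L` jointly
irreducible, `Q i = ∑ₘ τ i m • P m`. Fix `j`; for `k ≠ j` let `R k` be the residue of `Q k`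
with respect to `Q j`, with mixture proportion `η k ∈ Δ_L`. Then
`η₁, …, η_{j−1}, τ_j, η_{j+1}, …, η_K` are linearly independent. -/
theorem stmt11 {X : Type*} [MeasurableSpace X] {K L : ℕ}
    (P : Fin L → Measure X) [∀ m, IsProbabilityMeasure (P m)]
    (hJI : JointlyIrreducible P)
    (τ : Fin K → Fin L → ℝ) (hτΔ : ∀ i, τ i ∈ stdSimplex ℝ (Fin L))
    (hτind : LinearIndependent ℝ τ)
    (Q : Fin K → Measure X) [∀ i, IsProbabilityMeasure (Q i)]
    (hQ : ∀ i, (Q i).toSignedMeasure = ∑ m, τ i m • (P m).toSignedMeasure)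
    (j : Fin K)
    (R : Fin K → Measure X) [∀ k, IsProbabilityMeasure (R k)]
    (hR : ∀ k, k ≠ j → (Q k).toSignedMeasure
      = (1 - kappaTwo (Q k) (Q j)) • (R k).toSignedMeasure
        + kappaTwo (Q k) (Q j) • (Q j).toSignedMeasure)
    (η : Fin K → Fin L → ℝ) (hηΔ : ∀ k, k ≠ j → η k ∈ stdSimplex ℝ (Fin L))
    (hRη : ∀ k, k ≠ j → (R k).toSignedMeasure = ∑ m, η k m • (P m).toSignedMeasure) :
    LinearIndependent ℝ (fun k : Fin K => if k = j then τ j else η k) := by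
  have hP := hJI.linearIndependent
  set κ : Fin K → ℝ := fun k => kappaTwo (Q k) (Q j)
  have hτη : ∀ k, k ≠ j → τ k = (1 - κ k) • η k + κ k • τ j := by
    intro k hk
    apply hP.fintypeLinearCombination_injective
    have h := hR k hk
    rw [hQ k, hRη k hk, hQ j] at h
    simp only [Fintype.linearCombination_apply, h, Pi.add_apply, Pi.smul_apply, smul_eq_mul,
      add_smul, Finset.sum_add_distrib, mul_smul, ← Finset.smul_sum, κ]
  have hκ : ∀ k, k ≠ j → 1 - κ k ≠ 0 := by
    intro k hk h0
    have h := hτη k hk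
    rw [h0, show κ k = 1 by linarith, zero_smul, zero_add, one_smul] at h
    exact hk (hτind.injective h)
  have hc := (linearIndependent_add_smul_iff (R := ℝ) (v := τ)
    (c := fun k => if k = j then 0 else -κ k) (i := j) (by simp)).2 hτind
  convert! hc.units_smul (fun k => if hk : k = j then 1 else (Units.mk0 (1 - κ k) (hκ k hk))⁻¹)
    using 1
  funext k
  by_cases hk : k = j
  · simp [hk]
  · have : τ k + -κ k • τ j = (1 - κ k) • η k := by
      rw [hτη k hk]
      module
    simp only [Pi.smul_apply', Pi.add_apply, hk, if_false, dif_neg, not_false_eq_true, this]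
    simp [Units.smul_def, smul_smul, hκ k hk]
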